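/- Let d be a positive natural number and let A be a d×d real matrix with nonnegative entries. Then each trace tr(A^k) is nonnegative for k ≥ 1, and the directed graph induced by A is acyclic if and only if the finite sum ∑_{k=1}^{d} tr(A^k) = 0. -/

import Mathlib

/-- The directed graph induced by a matrix `A` (edge `i → j` iff `A i j ≠ 0`) is acyclic:
there is no `k ≥ 1` and sequence of vertices `i_0, …, i_k` with `i_0 = i_k` and
`A i_t i_{t+1} ≠ 0` for all `0 ≤ t < k`. -/
def Matrix.IsAcyclic {d : ℕ} (A : Matrix (Fin d) (Fin d) ℝ) : Prop :=
  ¬ ∃ (k : ℕ) (f : ℕ → Fin d), 1 ≤ k ∧ f k = f 0 ∧ ∀ t < k, A (f t) (f (t + 1)) ≠ 0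

namespace Matrix

section Walk

variable {n R : Type*} [Fintype n] [DecidableEq n]

/-- A nonzero entry of `A ^ k` comes from a walk of length `k` along nonzero entries of `A`. -/
theorem exists_walk_of_pow_apply_ne_zero [Semiring R] {A : Matrix n n R} {k : ℕ} {i j : n}
    (h : (A ^ k) i j ≠ 0) :
    ∃ f : ℕ → n, f 0 = i ∧ f k = j ∧ ∀ t < k, A (f t) (f (t + 1)) ≠ 0 := by
  induction k generalizing i with
  | zero =>
    have hij : i = j := by
      by_contra hne
      exact h (by simp [hne])
    exact ⟨fun _ => i, rfl, hij, by simp⟩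
  | succ k ih =>
    rw [pow_succ', mul_apply] at h
    obtain ⟨l, -, hl⟩ := Finset.exists_ne_zero_of_sum_ne_zero h
    obtain ⟨f, hf0, hfk, hf⟩ := ih (right_ne_zero_of_mul hl)
    refine ⟨fun t => Nat.casesOn t i f, rfl, hfk, fun t ht => ?_⟩
    cases t with
    | zero => simpa [hf0] using left_ne_zero_of_mul hl
    | succ t => exact hf t (by lia)

/-- For an entrywise nonnegative matrix, a walk of length `k` along nonzero entries makes the
corresponding entry of `A ^ k` positive. -/
theorem pow_apply_pos_of_walk [Semiring R] [LinearOrder R] [IsStrictOrderedRing R]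
    {A : Matrix n n R} (hA : ∀ i j, 0 ≤ A i j) {k : ℕ} {f : ℕ → n}
    (hf : ∀ t < k, A (f t) (f (t + 1)) ≠ 0) : 0 < (A ^ k) (f 0) (f k) := by
  induction k with
  | zero => simp
  | succ k ih =>
    rw [pow_succ, mul_apply]
    refine Finset.sum_pos' (fun l _ => mul_nonneg (pow_apply_nonneg hA k _ _) (hA _ _))
      ⟨f k, Finset.mem_univ _, mul_pos (ih fun t ht => hf t (by lia)) ?_⟩
    exact (hA _ _).lt_of_ne' (hf k (by lia))

end Walk

/-- A closed walk can be shortened to one of length at most the number of vertices. -/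
theorem exists_short_closed_walk {d : ℕ} {r : Fin d → Fin d → Prop} {k : ℕ} {f : ℕ → Fin d}
    (hk : 1 ≤ k) (hclosed : f k = f 0) (hf : ∀ t < k, r (f t) (f (t + 1))) :
    ∃ (m : ℕ) (g : ℕ → Fin d), 1 ≤ m ∧ m ≤ d ∧ g m = g 0 ∧ ∀ t < m, r (g t) (g (t + 1)) := by
  rcases le_or_gt k d with hkd | hkd
  · exact ⟨k, f, hk, hkd, hclosed, hf⟩
  · obtain ⟨a, b, hab, hfab⟩ : ∃ a b : Fin (d + 1), a < b ∧ f a = f b := by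
      obtain ⟨a, b, hne, h⟩ :=
        Fintype.exists_ne_map_eq_of_card_lt (fun t : Fin (d + 1) => f t) (by simp)
      rcases lt_or_gt_of_ne hne with hlt | hlt
      · exact ⟨a, b, hlt, h⟩
      · exact ⟨b, a, hlt, h.symm⟩
    have hlt : (a : ℕ) < b := hab
    refine ⟨b - a, fun t => f (a + t), by lia, by lia, ?_, fun t ht => hf _ (by lia)⟩
    simp only [Nat.add_sub_cancel' hlt.le, add_zero, hfab]

end Matrix

theorem nonneg_acyclic_iff_finite_sum_trace_pow_eq_zero (d : ℕ) (hd : 0 < d)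
    (A : Matrix (Fin d) (Fin d) ℝ) (hA : ∀ i j, 0 ≤ A i j) :
    (∀ k : ℕ, 1 ≤ k → 0 ≤ Matrix.trace (A ^ k)) ∧
      (A.IsAcyclic ↔ ∑ k ∈ Finset.Icc 1 d, Matrix.trace (A ^ k) = 0) := by
  have hdiag (k : ℕ) (i : Fin d) : 0 ≤ (A ^ k) i i := Matrix.pow_apply_nonneg hA k i i
  have htrace (k : ℕ) : 0 ≤ Matrix.trace (A ^ k) := Finset.sum_nonneg fun i _ => hdiag k i
  refine ⟨fun k _ => htrace k, ?_⟩
  rw [Finset.sum_eq_zero_iff_of_nonneg fun k _ => htrace k]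
  constructor
  · intro hacyclic k hk
    refine Finset.sum_eq_zero fun i _ => ?_
    by_contra hne
    obtain ⟨f, hf0, hfk, hf⟩ := Matrix.exists_walk_of_pow_apply_ne_zero hne
    exact hacyclic ⟨k, f, (Finset.mem_Icc.mp hk).1, hfk.trans hf0.symm, hf⟩
  · rintro hzero ⟨k, f, hk, hclosed, hf⟩
    obtain ⟨m, g, hm, hmd, hgclosed, hg⟩ :=
      Matrix.exists_short_closed_walk (r := fun i j => A i j ≠ 0) hk hclosed hf
    have hpos := Matrix.pow_apply_pos_of_walk hA hg
    rw [hgclosed] at hpos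
    have hdiag_zero := (Finset.sum_eq_zero_iff_of_nonneg fun i _ => hdiag m i).mp
      (hzero m (Finset.mem_Icc.mpr ⟨hm, hmd⟩)) (g 0) (Finset.mem_univ _)
    exact hpos.ne' hdiag_zero
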